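/- Suppose f ∈ L²(ℝ) is phase-space localized with tolerance δ₁. Then for every integer M ≥ 0, ‖Σ_{m=0}^{M} f⁺ₘ − [(1−P₀)f + Σ_{m=1}^{M} (1−Pₘ)(Pₘ₋₁ ⋯ P₁ P₀) f]‖_{L²} ≤ δ₁·(M³ + 9M² + (20 + 150·kmax)·M + 150·kmax + 12·kmax + 12(M+1))·‖f‖_{L²}. -/

import Mathlib

open MeasureTheory Real Complex Set Function
open scoped ENNReal

noncomputable section

/-- The error function `erf x = (2/√π) ∫₀ˣ e^{-t²} dt`. -/
def erf' (x : ℝ) : ℝ := (2 / Real.sqrt Real.pi) * ∫ t in (0:ℝ)..x, Real.exp (-t^2)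

/-- The complementary error function `erfc x = 1 - erf x`. -/
def erfc' (x : ℝ) : ℝ := 1 - erf' x

/-- The inverse of the strictly decreasing bijection `erfc' : [0,∞) → (0,1]`. -/
def erfcInv (y : ℝ) : ℝ := Function.invFunOn erfc' (Set.Ici 0) y

/-- The spatial cutoff χ₀(x) = (1/2)[erf((x+3L/4)/σ) − erf((x−3L/4)/σ)]. -/
def chi0 (L σ x : ℝ) : ℝ := (1/2) * (erf' ((x + 3*L/4)/σ) - erf' ((x - 3*L/4)/σ))

/-- The frequency cutoff P₀(k) = (1/2)[erf(σ(k+3kmax/8)) − erf(σ(k−3kmax/8))]. -/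
def P0fun (kmax σ k : ℝ) : ℝ := (1/2) * (erf' (σ*(k + 3*kmax/8)) - erf' (σ*(k - 3*kmax/8)))

/-- The scaled spatial cutoff χₘ(x) = χ₀(2^{-m} x). -/
def chiSc (L σ : ℝ) (m : ℕ) (x : ℝ) : ℝ := chi0 L σ (x / 2^m)

/-- The scaled frequency cutoff Pₘ(k) = P₀(2^m k). -/
def PSc (kmax σ : ℝ) (m : ℕ) (k : ℝ) : ℝ := P0fun kmax σ (2^m * k)

/-- Fourier transform with the convention f̂(k) = (2π)^{-1/2} ∫ f(x) e^{-ikx} dx. -/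
def ft (f : ℝ → ℂ) (k : ℝ) : ℂ :=
  (Real.sqrt (2*Real.pi) : ℂ)⁻¹ * ∫ x : ℝ, Complex.exp (-(Complex.I * k * x)) * f x

/-- Inverse Fourier transform with the convention (2π)^{-1/2} ∫ g(k) e^{ikx} dk. -/
def ift (g : ℝ → ℂ) (x : ℝ) : ℂ :=
  (Real.sqrt (2*Real.pi) : ℂ)⁻¹ * ∫ k : ℝ, Complex.exp (Complex.I * k * x) * g k

/-- The space L²(ℝ, ℂ). -/
abbrev L2 := Lp ℂ 2 (volume : Measure ℝ)

/-- `T` is the bounded Fourier multiplier operator on L² with symbol `m`: on the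
dense set of `f ∈ L¹ ∩ L²` with integrable Fourier transform, `T f = 𝓕⁻¹(m·𝓕f)`.
(This uniquely determines `T` for a bounded symbol.) -/
def IsMultOp (m : ℝ → ℝ) (T : L2 →L[ℂ] L2) : Prop :=
  ∀ f : L2, Integrable (f : ℝ → ℂ) volume → Integrable (ft (f : ℝ → ℂ)) volume →
    (T f : ℝ → ℂ) =ᵐ[volume] ift (fun k => (m k : ℂ) * ft (f : ℝ → ℂ) k)

/-- `T` is the operator of pointwise multiplication by the real function `c`. -/
def IsMulBy (c : ℝ → ℝ) (T : L2 →L[ℂ] L2) : Prop :=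
  ∀ f : L2, (T f : ℝ → ℂ) =ᵐ[volume] fun x => (c x : ℂ) * f x

/-! ### The error function -/

theorem continuous_erf' : Continuous erf' := by
  unfold erf'
  refine continuous_const.mul ?_
  exact intervalIntegral.continuous_primitive (μ := volume)
    (fun a b => (by fun_prop : Continuous fun t : ℝ => Real.exp (-t ^ 2)).intervalIntegrable a b) 0

theorem erf'_zero : erf' 0 = 0 := by simp [erf']

theorem erf'_neg (x : ℝ) : erf' (-x) = -erf' x := by
  have h := intervalIntegral.integral_comp_neg (a := 0) (b := x)
    (fun t : ℝ => Real.exp (-t ^ 2))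
  simp only [neg_sq, neg_zero] at h
  rw [erf', erf', h, intervalIntegral.integral_symm]
  ring

theorem strictMono_erf' : StrictMono erf' := by
  intro x y hxy
  have hc : Continuous fun t : ℝ => Real.exp (-t ^ 2) := by fun_prop
  have hpos : 0 < ∫ t in x..y, Real.exp (-t ^ 2) :=
    intervalIntegral.intervalIntegral_pos_of_pos (hc.intervalIntegrable x y)
      (fun t => Real.exp_pos _) hxy
  have hsub := intervalIntegral.integral_interval_sub_left (μ := volume)
    (hc.intervalIntegrable 0 y) (hc.intervalIntegrable 0 x)
  have hπ : 0 < 2 / √Real.pi := by positivity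
  unfold erf'
  apply mul_lt_mul_of_pos_left _ hπ
  linarith

theorem tendsto_erf' : Filter.Tendsto erf' Filter.atTop (nhds 1) := by
  have hint : IntegrableOn (fun t : ℝ => Real.exp (-t ^ 2)) (Ioi 0) := by
    simpa using (integrable_exp_neg_mul_sq one_pos).integrableOn (s := Ioi (0 : ℝ))
  have h := intervalIntegral_tendsto_integral_Ioi (μ := volume) 0 hint Filter.tendsto_id
  have hG : ∫ t in Ioi (0 : ℝ), Real.exp (-t ^ 2) = √Real.pi / 2 := by
    simpa using integral_gaussian_Ioi 1
  rw [hG] at h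
  have h2 := h.const_mul (2 / √Real.pi)
  have hπ : √Real.pi ≠ 0 := by positivity
  rwa [show 2 / √Real.pi * (√Real.pi / 2) = 1 by field_simp] at h2

theorem erf'_le_one (x : ℝ) : erf' x ≤ 1 :=
  strictMono_erf'.monotone.ge_of_tendsto tendsto_erf' x

theorem neg_one_le_erf' (x : ℝ) : -1 ≤ erf' x := by
  have := erf'_le_one (-x)
  rw [erf'_neg] at this
  linarith

theorem exists_erfc'_eq {δ : ℝ} (hδ : 0 < δ) (hδ1 : δ ≤ erfc' 1) :
    ∃ a ∈ Ici (0 : ℝ), erfc' a = δ := by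
  obtain ⟨b, hb, hb1⟩ := ((tendsto_erf'.eventually_const_lt (show 1 - δ < 1 by linarith)).and
    (Filter.eventually_ge_atTop 1)).exists
  have hc : ContinuousOn erfc' (Icc 1 b) := (continuous_const.sub continuous_erf').continuousOn
  obtain ⟨a, ha, rfl⟩ := intermediate_value_Icc' hb1 hc
    ⟨(by unfold erfc'; linarith : erfc' b ≤ δ), hδ1⟩
  exact ⟨a, zero_le_one.trans ha.1, rfl⟩

theorem erfc'_erfcInv {δ : ℝ} (hδ : 0 < δ) (hδ1 : δ ≤ erfc' 1) : erfc' (erfcInv δ) = δ :=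
  Function.invFunOn_eq (exists_erfc'_eq hδ hδ1)

theorem erfcInv_pos {δ : ℝ} (hδ : 0 < δ) (hδ1 : δ ≤ erfc' 1) : 0 < erfcInv δ := by
  refine strictMono_erf'.lt_iff_lt.mp ?_
  have h := erfc'_erfcInv hδ hδ1
  have h1 := strictMono_erf' one_pos
  unfold erfc' at h hδ1
  linarith

/-! ### Smoothed indicator functions -/

/-- The indicator function of `[-W, W]`, smoothed by a standard Gaussian. -/
def smoothBox (W t : ℝ) : ℝ := (1 / 2) * (erf' (t + W) - erf' (t - W))

theorem continuous_smoothBox (W : ℝ) : Continuous (smoothBox W) := by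
  have := continuous_erf'
  unfold smoothBox
  fun_prop

theorem smoothBox_abs (W t : ℝ) : smoothBox W |t| = smoothBox W t := by
  rcases abs_choice t with h | h <;> rw [h]
  have h1 : -t + W = -(t - W) := by ring
  have h2 : -t - W = -(t + W) := by ring
  rw [smoothBox, h1, h2, erf'_neg, erf'_neg, smoothBox]
  ring

theorem smoothBox_nonneg {W : ℝ} (hW : 0 ≤ W) (t : ℝ) : 0 ≤ smoothBox W t := by
  have := strictMono_erf'.monotone (show t - W ≤ t + W by linarith)
  unfold smoothBox
  linarith

theorem smoothBox_le_one (W t : ℝ) : smoothBox W t ≤ 1 := by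
  have h1 := erf'_le_one (t + W)
  have h2 := neg_one_le_erf' (t - W)
  unfold smoothBox
  linarith

/-- Dilating a wide smoothed box by a factor at least two makes it almost equal to one where the
original box is not negligible. -/
theorem one_sub_smoothBox_mul_le {a W t t' : ℝ} (ha : 0 ≤ a) (hW : 3 * a ≤ W)
    (htt' : 2 * |t| ≤ |t'|) : (1 - smoothBox W t) * smoothBox W t' ≤ erfc' a := by
  have hW0 : 0 ≤ W := by linarith
  have ht := abs_nonneg t
  have hδ : 0 ≤ erfc' a := by have := erf'_le_one a; unfold erfc'; linarith
  rw [← smoothBox_abs W t, ← smoothBox_abs W t']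
  generalize |t| = s at *
  generalize |t'| = s' at *
  have h0 := smoothBox_nonneg hW0 s
  have h1 := smoothBox_le_one W s
  have h0' := smoothBox_nonneg hW0 s'
  have h1' := smoothBox_le_one W s'
  rcases le_total s (W - a) with h | h
  · have hb : 1 - smoothBox W s ≤ erfc' a := by
      have h2 := strictMono_erf'.monotone (show a ≤ s + W by linarith)
      have h3 := strictMono_erf'.monotone (show s - W ≤ -a by linarith)
      rw [erf'_neg] at h3
      unfold smoothBox erfc'
      linarith
    nlinarith
  · have hb : smoothBox W s' ≤ erfc' a := by
      have h2 := erf'_le_one (s' + W)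
      have h3 := strictMono_erf'.monotone (show a ≤ s' - W by linarith)
      unfold erfc' at hδ ⊢
      unfold smoothBox
      linarith
    nlinarith

theorem chiSc_eq (L σ : ℝ) (m : ℕ) (x : ℝ) :
    chiSc L σ m x = smoothBox (3 * L / 4 / σ) (x / 2 ^ m / σ) := by
  rw [chiSc, chi0, smoothBox, add_div, sub_div]

theorem PSc_eq (kmax σ : ℝ) (m : ℕ) (k : ℝ) :
    PSc kmax σ m k = smoothBox (σ * (3 * kmax / 8)) (σ * (2 ^ m * k)) := by
  rw [PSc, P0fun, smoothBox, ← mul_add, ← mul_sub]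

/-! ### The decomposition in an abstract Hilbert space -/

section Abstract

variable {H : Type*} [NormedAddCommGroup H] [InnerProductSpace ℂ H]

theorem norm_sq_le_re_inner_of_norm_sub_two_smul_le {u v : H} (h : ‖u - (2 : ℂ) • v‖ ≤ ‖u‖) :
    ‖v‖ ^ 2 ≤ (inner ℂ u v).re := by
  have h2 : ‖u - (2 : ℂ) • v‖ ^ 2 ≤ ‖u‖ ^ 2 := by gcongr
  rw [norm_sub_sq (𝕜 := ℂ), norm_smul, inner_smul_right] at h2
  simp at h2
  linarith

/-- If `X` is a symmetric contraction and `Q` satisfies `0 ≤ Q ≤ 1`, then `1 - X Q X` is a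
contraction. -/
theorem norm_sub_comp_comp_le {X Q : H →L[ℂ] H} (hX : ∀ u, ‖X u‖ ≤ ‖u‖)
    (hXs : ∀ u v, inner ℂ (X u) v = inner ℂ u (X v))
    (hQ : ∀ u, ‖u - (2 : ℂ) • Q u‖ ≤ ‖u‖) (u : H) : ‖u - X (Q (X u))‖ ≤ ‖u‖ := by
  have h1 := norm_sq_le_re_inner_of_norm_sub_two_smul_le (hQ (X u))
  have h2 : ‖X (Q (X u))‖ ^ 2 ≤ ‖Q (X u)‖ ^ 2 := by gcongr; exact hX _
  have h3 : ‖u - X (Q (X u))‖ ^ 2 ≤ ‖u‖ ^ 2 := by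
    rw [norm_sub_sq (𝕜 := ℂ), ← hXs]
    simp only [RCLike.re_eq_complex_re]
    nlinarith [sq_nonneg ‖Q (X u)‖]
  exact le_of_sq_le_sq h3 (norm_nonneg _)

variable {X P R : ℕ → (H →L[ℂ] H)} {δ : ℝ}

theorem norm_apply_sub_prod_le (hP : ∀ m u, ‖P m u‖ ≤ ‖u‖)
    (hPQ : ∀ i j u, i < j → ‖P j (u - P i u)‖ ≤ δ * ‖u‖)
    (hR0 : R 0 = 1) (hRS : ∀ m, R (m + 1) = (P m).comp (R m)) (hδ : 0 ≤ δ) (u : H)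
    (n : ℕ) : ‖R n u‖ ≤ ‖u‖ ∧ ∀ j, n ≤ j → ‖P j (u - R n u)‖ ≤ n * δ * ‖u‖ := by
  induction n with
  | zero => simp [hR0]
  | succ n ih =>
    obtain ⟨ih1, ih2⟩ := ih
    rw [hRS]
    refine ⟨(hP _ _).trans ih1, fun j hj => ?_⟩
    have h1 := ih2 j (by lia)
    have h2 : ‖P j (R n u - P n (R n u))‖ ≤ δ * ‖u‖ :=
      (hPQ n j _ (by lia)).trans (by gcongr)
    have h3 : P j (u - ((P n).comp (R n)) u)
        = P j (u - R n u) + P j (R n u - P n (R n u)) := by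
      simp
    rw [h3]
    push_cast
    linarith [norm_add_le (P j (u - R n u)) (P j (R n u - P n (R n u)))]

/-- The localization defect at one scale is small on the low-frequency part cut off at the previous
scale. -/
theorem norm_defect_le (hX : ∀ m u, ‖X m u‖ ≤ ‖u‖) (hX1 : ∀ m u, ‖u - X m u‖ ≤ ‖u‖)
    (hXX : ∀ m u, ‖X m u - X (m + 1) (X m u)‖ ≤ δ * ‖u‖)
    (hP1 : ∀ m u, ‖u - P m u‖ ≤ ‖u‖)
    (hPQ : ∀ i j u, i < j → ‖P j (u - P i u)‖ ≤ δ * ‖u‖) (hδ : 0 ≤ δ) {f : H}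
    (hloc : ∀ m, ‖(1 - P m) f - X m ((1 - P m) (X m f))‖ ≤ δ * ‖f‖) (m : ℕ) :
    ‖(1 - P (m + 1)) (P m f) - X (m + 1) ((1 - P (m + 1)) (X (m + 1) (P m f)))‖
      ≤ 6 * δ * ‖f‖ := by
  simp only [sub_apply, one_apply_eq_self] at *
  set Y := X (m + 1)
  set S := P (m + 1)
  set h := f - P m f with hh
  set w := X m (X m f - P m (X m f)) with hw
  have e1 : ‖h - Y h‖ ≤ 2 * δ * ‖f‖ := by
    have a1 : ‖w - Y w‖ ≤ δ * ‖f‖ :=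
      (hXX m _).trans (by gcongr; exact (hP1 m _).trans (hX m f))
    have a2 : ‖(h - w) - Y (h - w)‖ ≤ δ * ‖f‖ := (hX1 _ _).trans (hloc m)
    have a3 : h - Y h = (w - Y w) + ((h - w) - Y (h - w)) := by
      rw [map_sub Y h w]; abel
    rw [a3]
    linarith [norm_add_le (w - Y w) ((h - w) - Y (h - w))]
  have e2 : ‖S h‖ ≤ δ * ‖f‖ := hPQ m (m + 1) f (by lia)
  have e3 : ‖S h - Y (S h)‖ ≤ δ * ‖f‖ := (hX1 _ _).trans e2
  have e4 : ‖Y ((h - Y h) - S (h - Y h))‖ ≤ 2 * δ * ‖f‖ :=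
    (hX _ _).trans ((hP1 _ _).trans e1)
  have e5 := hloc (m + 1)
  have key : P m f - S (P m f) - Y (Y (P m f) - S (Y (P m f)))
      = (f - S f - Y (Y f - S (Y f))) - (h - Y h) + (S h - Y (S h))
        - Y ((h - Y h) - S (h - Y h)) := by
    rw [hh]
    simp only [map_sub]
    abel
  rw [key]
  have t1 := norm_sub_le ((f - S f - Y (Y f - S (Y f))) - (h - Y h) + (S h - Y (S h)))
    (Y ((h - Y h) - S (h - Y h)))
  have t2 := norm_add_le ((f - S f - Y (Y f - S (Y f))) - (h - Y h)) (S h - Y (S h))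
  have t3 := norm_sub_le (f - S f - Y (Y f - S (Y f))) (h - Y h)
  linarith

/-- The remainder of the multiscale decomposition is close to the product of the low-pass filters. -/
theorem norm_remainder_sub_prod_le (hX : ∀ m u, ‖X m u‖ ≤ ‖u‖)
    (hX1 : ∀ m u, ‖u - X m u‖ ≤ ‖u‖)
    (hXs : ∀ m u v, inner ℂ (X m u) v = inner ℂ u (X m v))
    (hXX : ∀ m u, ‖X m u - X (m + 1) (X m u)‖ ≤ δ * ‖u‖)
    (hP : ∀ m u, ‖P m u‖ ≤ ‖u‖) (hP1 : ∀ m u, ‖u - P m u‖ ≤ ‖u‖)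
    (hP2 : ∀ m u, ‖u - (2 : ℂ) • P m u‖ ≤ ‖u‖)
    (hPQ : ∀ i j u, i < j → ‖P j (u - P i u)‖ ≤ δ * ‖u‖) (hδ : 0 ≤ δ) {f : H}
    (hloc : ∀ m, ‖(1 - P m) f - X m ((1 - P m) (X m f))‖ ≤ δ * ‖f‖)
    {fp fm : ℕ → H} (hfp0 : fp 0 = X 0 ((1 - P 0) (X 0 f))) (hfm0 : fm 0 = f - fp 0)
    (hfpS : ∀ m, fp (m + 1) = X (m + 1) ((1 - P (m + 1)) (X (m + 1) (fm m))))
    (hfmS : ∀ m, fm (m + 1) = fm m - fp (m + 1))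
    (hR0 : R 0 = 1) (hRS : ∀ m, R (m + 1) = (P m).comp (R m)) (M : ℕ) :
    ‖fm M - R (M + 1) f‖ ≤ (M ^ 2 + 7 * M + 1) * δ * ‖f‖ := by
  have hQ : ∀ m u, ‖u - (2 : ℂ) • (1 - P m) u‖ ≤ ‖u‖ := fun m u => by
    have : u - (2 : ℂ) • (1 - P m) u = -(u - (2 : ℂ) • P m u) := by
      simp only [sub_apply, one_apply_eq_self]
      module
    rw [this, norm_neg]
    exact hP2 m u
  have hQ1 : ∀ m u, ‖(1 - P m) u‖ ≤ ‖u‖ := hP1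
  induction M with
  | zero =>
    have : fm 0 - R (0 + 1) f = (1 - P 0) f - X 0 ((1 - P 0) (X 0 f)) := by
      rw [hfm0, hfp0, hRS, hR0]
      simp only [sub_apply, one_apply_eq_self,
        ContinuousLinearMap.comp_apply]
      abel
    rw [this]
    simpa using hloc 0
  | succ M ih =>
    set D : H →L[ℂ] H := (1 - P (M + 1)) - (X (M + 1)).comp ((1 - P (M + 1)).comp (X (M + 1)))
      with hD
    set e := fm M - R (M + 1) f with he
    have hcontr := norm_sub_comp_comp_le (hX (M + 1)) (hXs (M + 1)) (hQ (M + 1)) e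
    have hsplit : fm (M + 1) - R (M + 1 + 1) f
        = (e - X (M + 1) ((1 - P (M + 1)) (X (M + 1) e))) + D (R (M + 1) f) := by
      rw [hfmS, hfpS, hRS (M + 1), he, hD]
      simp only [sub_apply, one_apply_eq_self,
        ContinuousLinearMap.comp_apply, map_sub]
      abel
    have hlow : ‖D (P M f)‖ ≤ 6 * δ * ‖f‖ := norm_defect_le hX hX1 hXX hP1 hPQ hδ hloc M
    have hDn : ∀ u, ‖D u‖ ≤ 2 * ‖u‖ := fun u => by
      have h0 := norm_sub_le ((1 - P (M + 1)) u)
        (X (M + 1) ((1 - P (M + 1)) (X (M + 1) u)))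
      have h1 := hQ1 (M + 1) u
      have h2 : ‖X (M + 1) ((1 - P (M + 1)) (X (M + 1) u))‖ ≤ ‖u‖ :=
        (hX _ _).trans ((hQ1 _ _).trans (hX _ _))
      exact h0.trans (by linarith)
    have hprod := (norm_apply_sub_prod_le hP hPQ hR0 hRS hδ f M).2 M le_rfl
    have hDR : D (R (M + 1) f) = D (P M f) - D (P M (f - R M f)) := by
      rw [hRS M, ContinuousLinearMap.comp_apply, map_sub (P M), map_sub D]
      abel
    have h1 := norm_sub_le (D (P M f)) (D (P M (f - R M f)))
    have h2 := hDn (P M (f - R M f))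
    have h3 := norm_add_le (e - X (M + 1) ((1 - P (M + 1)) (X (M + 1) e))) (D (R (M + 1) f))
    rw [hsplit]
    rw [← hDR] at h1
    rw [Nat.cast_succ]
    have h4 : (0 : ℝ) ≤ δ * ‖f‖ := by positivity
    linarith

theorem sum_telescope_prod (f : H) (hR0 : R 0 = 1) (hRS : ∀ m, R (m + 1) = (P m).comp (R m))
    (M : ℕ) : (1 - P 0) f + ∑ m ∈ Finset.Icc 1 M, (1 - P m) (R m f) = f - R (M + 1) f := by
  induction M with
  | zero => simp [hRS, hR0]
  | succ M ih =>
    rw [Finset.sum_Icc_succ_top (by lia), ← add_assoc, ih, hRS (M + 1)]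
    simp

end Abstract

theorem sum_eq_sub_remainder {H : Type*} [AddCommGroup H] {f : H} {fp fm : ℕ → H}
    (hfm0 : fm 0 = f - fp 0)
    (hfmS : ∀ m, fm (m + 1) = fm m - fp (m + 1)) (M : ℕ) :
    ∑ m ∈ Finset.range (M + 1), fp m = f - fm M := by
  induction M with
  | zero => simp [hfm0]
  | succ M ih => rw [Finset.sum_range_succ, ih, hfmS]; abel


/-! ### Multiplication operators and Fourier multipliers on `L²` -/

namespace IsMulBy

variable {b c : ℝ → ℝ} {S T : L2 →L[ℂ] L2}

theorem one : IsMulBy 1 1 := fun f => by simp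

theorem sub (hS : IsMulBy b S) (hT : IsMulBy c T) : IsMulBy (b - c) (S - T) := fun f => by
  filter_upwards [hS f, hT f, Lp.coeFn_sub (S f) (T f)] with x h1 h2 h3
  rw [sub_apply, h3, Pi.sub_apply, h1, h2]
  simp [sub_mul]

theorem smul (hT : IsMulBy c T) (a : ℝ) : IsMulBy (a • c) ((a : ℂ) • T) := fun f => by
  filter_upwards [hT f, Lp.coeFn_smul (a : ℂ) (T f)] with x h1 h2
  rw [smul_apply, h2, Pi.smul_apply, h1]
  simp [mul_assoc]

theorem comp (hS : IsMulBy b S) (hT : IsMulBy c T) : IsMulBy (b * c) (S.comp T) := fun f => by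
  filter_upwards [hS (T f), hT f] with x h1 h2
  rw [ContinuousLinearMap.comp_apply, h1, h2]
  simp [mul_assoc]

theorem norm_apply_le (hT : IsMulBy c T) {C : ℝ} (hc : ∀ x, |c x| ≤ C) (f : L2) :
    ‖T f‖ ≤ C * ‖f‖ := by
  refine Lp.norm_le_mul_norm_of_ae_le_mul ?_
  filter_upwards [hT f] with x hx
  rw [hx, norm_mul, Complex.norm_real, Real.norm_eq_abs]
  gcongr
  exact hc x

theorem inner_apply_left (hT : IsMulBy c T) (f g : L2) :
    inner ℂ (T f) g = inner ℂ f (T g) := by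
  rw [L2.inner_def, L2.inner_def]
  refine integral_congr_ae ?_
  filter_upwards [hT f, hT g] with x hf hg
  simp only [hf, hg, RCLike.inner_apply, map_mul, Complex.conj_ofReal]
  ring

end IsMulBy

theorem exists_isMulBy {c : ℝ → ℝ} (hc : Continuous c) {C : ℝ} (hC : ∀ x, |c x| ≤ C) :
    ∃ T : L2 →L[ℂ] L2, IsMulBy c T := by
  have hmem : MemLp (fun x => (c x : ℂ)) ⊤ (volume : Measure ℝ) :=
    memLp_top_of_bound (Complex.continuous_ofReal.comp hc).aestronglyMeasurable C
      (Filter.Eventually.of_forall fun x => by simpa using hC x)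
  refine ⟨(ContinuousLinearMap.mul ℂ ℂ).holderL volume ⊤ 2 2 hmem.toLp, fun f => ?_⟩
  filter_upwards [(ContinuousLinearMap.mul ℂ ℂ).coeFn_holder (r := 2) hmem.toLp f,
    hmem.coeFn_toLp] with x h1 h2
  rw [ContinuousLinearMap.holderL_apply_apply, h1, h2]
  rfl

open scoped FourierTransform SchwartzMap

theorem ft_eq_fourier (f : ℝ → ℂ) (k : ℝ) :
    ft f k = (√(2 * Real.pi) : ℂ)⁻¹ * 𝓕 f (k / (2 * Real.pi)) := by
  rw [ft, Real.fourier_real_eq_integral_exp_smul]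
  congr 2
  ext x
  rw [smul_eq_mul]
  congr 2
  push_cast
  have : (Real.pi : ℂ) ≠ 0 := by simp [Real.pi_ne_zero]
  field_simp

theorem ift_eq_fourierInv (g : ℝ → ℂ) (x : ℝ) :
    ift g x = √(2 * Real.pi) * 𝓕⁻ (fun ξ : ℝ => g (2 * Real.pi * ξ)) x := by
  have h2π : (0 : ℝ) < 2 * Real.pi := by positivity
  have h := Measure.integral_comp_mul_left
    (fun k : ℝ => Complex.exp (Complex.I * k * x) * g k) (2 * Real.pi)
  have hI : 𝓕⁻ (fun ξ : ℝ => g (2 * Real.pi * ξ)) x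
      = ∫ ξ : ℝ, Complex.exp (Complex.I * (2 * Real.pi * ξ : ℝ) * x) * g (2 * Real.pi * ξ) := by
    rw [Real.fourierInv_eq']
    congr 1
    ext ξ
    rw [smul_eq_mul]
    congr 2
    simp
    ring
  rw [hI, h, ift, abs_of_pos (inv_pos.2 h2π), Complex.real_smul, ← mul_assoc]
  congr 1
  norm_cast
  have := Real.mul_self_sqrt h2π.le
  have h0 : √(2 * Real.pi) ≠ 0 := by positivity
  field_simp
  linarith

theorem ift_mul_ft_eq (m : ℝ → ℝ) (f : ℝ → ℂ) :
    ift (fun k => (m k : ℂ) * ft f k)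
      = 𝓕⁻ (fun ξ : ℝ => (m (2 * Real.pi * ξ) : ℂ) * 𝓕 f ξ) := by
  ext x
  have h2π : (2 * Real.pi : ℝ) ≠ 0 := by positivity
  have h0 : (√(2 * Real.pi) : ℂ) ≠ 0 := by
    simpa using Real.sqrt_ne_zero'.2 (by positivity : (0 : ℝ) < 2 * Real.pi)
  rw [ift_eq_fourierInv, Real.fourierInv_eq, Real.fourierInv_eq, ← integral_const_mul]
  congr 1
  ext ξ
  rw [ft_eq_fourier, mul_div_cancel_left₀ _ h2π]
  simp only [Circle.smul_def, smul_eq_mul]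
  field_simp

/-- The Fourier transform on `L²` as a linear isometry. -/
abbrev fourierL2 : L2 ≃ₗᵢ[ℂ] L2 := Lp.fourierTransformₗᵢ ℝ ℂ

theorem integral_conj_mul_fourierInv (φ : 𝓢(ℝ, ℂ)) {h : ℝ → ℂ} (hh : Integrable h) :
    ∫ x, inner ℂ (φ x) (𝓕⁻ h x) = ∫ ξ, inner ℂ (𝓕 φ ξ) (h ξ) := by
  have key := VectorFourier.integral_sesq_fourierIntegral_eq_neg_flip (innerSL ℂ (E := ℂ))
    (μ := volume) (ν := volume) (L := innerₗ ℝ)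
    Real.continuous_fourierChar continuous_inner φ.integrable hh
  refine Eq.trans ?_ key.symm
  congr 1
  ext x
  congr 1
  simp [Real.fourierInv_eq, VectorFourier.fourierIntegral]

theorem ft_schwartz_integrable (φ : 𝓢(ℝ, ℂ)) : Integrable (ft φ) := by
  have h1 : ft φ = fun k => (√(2 * Real.pi) : ℂ)⁻¹ * (𝓕 φ) (k / (2 * Real.pi)) := by
    ext k
    exact ft_eq_fourier φ k
  rw [h1]
  exact ((𝓕 φ).integrable.comp_div (by positivity)).const_mul _

theorem IsMultOp.apply_schwartz {m : ℝ → ℝ} {T : L2 →L[ℂ] L2} (hT : IsMultOp m T)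
    (φ : 𝓢(ℝ, ℂ)) : (T (φ.toLp 2) : ℝ → ℂ) =ᵐ[volume]
      𝓕⁻ (fun ξ : ℝ => (m (2 * Real.pi * ξ) : ℂ) * 𝓕 φ ξ) := by
  have hφ : (φ.toLp 2 : ℝ → ℂ) =ᵐ[volume] φ := φ.coeFn_toLp 2
  have hft : ft (φ.toLp 2 : ℝ → ℂ) = ft φ := by
    ext k
    refine congrArg _ (integral_congr_ae ?_)
    filter_upwards [hφ] with x hx
    rw [hx]
  have h := hT (φ.toLp 2) (φ.integrable.congr hφ.symm)
    (by rw [hft]; exact ft_schwartz_integrable φ)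
  rwa [hft, ift_mul_ft_eq] at h

theorem IsMultOp.inner_schwartz {m : ℝ → ℝ} {T S : L2 →L[ℂ] L2} (hT : IsMultOp m T)
    (hm : Continuous m) {C : ℝ} (hC : ∀ k, |m k| ≤ C)
    (hS : IsMulBy (fun ξ => m (2 * Real.pi * ξ)) S) (φ ψ : 𝓢(ℝ, ℂ)) :
    inner ℂ (ψ.toLp 2) (T (φ.toLp 2)) = inner ℂ ((𝓕 ψ).toLp 2) (S ((𝓕 φ).toLp 2)) := by
  have hint : Integrable fun ξ : ℝ => (m (2 * Real.pi * ξ) : ℂ) * 𝓕 φ ξ :=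
    (𝓕 φ).integrable.bdd_mul (c := C)
      (by fun_prop : Continuous fun ξ : ℝ => (m (2 * Real.pi * ξ) : ℂ)).aestronglyMeasurable
      (Filter.Eventually.of_forall fun ξ => by simpa using hC _)
  rw [L2.inner_def, L2.inner_def]
  calc _ = ∫ x, inner ℂ (ψ x) (𝓕⁻ (fun ξ : ℝ => (m (2 * Real.pi * ξ) : ℂ) * 𝓕 φ ξ) x) := by
        refine integral_congr_ae ?_
        filter_upwards [hT.apply_schwartz φ, ψ.coeFn_toLp 2] with x h1 h2
        rw [h1, h2]
    _ = ∫ ξ, inner ℂ (𝓕 ψ ξ) ((m (2 * Real.pi * ξ) : ℂ) * 𝓕 φ ξ) :=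
        integral_conj_mul_fourierInv ψ hint
    _ = _ := by
        refine integral_congr_ae ?_
        filter_upwards [hS ((𝓕 φ).toLp 2), (𝓕 φ).coeFn_toLp 2, (𝓕 ψ).coeFn_toLp 2]
          with x h1 h2 h3
        rw [h1, h2, h3]

theorem fourierL2_toLp (φ : 𝓢(ℝ, ℂ)) : fourierL2 (φ.toLp 2) = (𝓕 φ).toLp 2 :=
  SchwartzMap.toLp_fourier_eq φ

theorem eq_of_eq_on_schwartz {S T : L2 →L[ℂ] L2}
    (h : ∀ φ : 𝓢(ℝ, ℂ), S (φ.toLp 2) = T (φ.toLp 2)) : S = T := by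
  have hdense := SchwartzMap.denseRange_toLpCLM (E := ℝ) (F := ℂ) (p := 2)
    (μ := (volume : Measure ℝ)) ENNReal.ofNat_ne_top
  exact DFunLike.coe_injective (hdense.equalizer S.continuous T.continuous (funext h))

theorem ext_inner_schwartz {u v : L2}
    (h : ∀ φ : 𝓢(ℝ, ℂ), inner ℂ (φ.toLp 2 : L2) u = inner ℂ (φ.toLp 2 : L2) v) : u = v := by
  have hdense := SchwartzMap.denseRange_toLpCLM (E := ℝ) (F := ℂ) (p := 2)
    (μ := (volume : Measure ℝ)) ENNReal.ofNat_ne_top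
  refine ext_inner_left ℂ fun w => ?_
  have := hdense.equalizer (g := fun w : L2 => inner ℂ w u) (h := fun w : L2 => inner ℂ w v)
    (continuous_id.inner continuous_const) (continuous_id.inner continuous_const) (funext h)
  exact congrFun this w

/-- Conjugation by the Fourier transform on `L²`. -/
def fourierConj (T : L2 →L[ℂ] L2) : L2 →L[ℂ] L2 :=
  (fourierL2 : L2 →L[ℂ] L2).comp (T.comp (fourierL2.symm : L2 →L[ℂ] L2))

theorem fourierConj_apply (T : L2 →L[ℂ] L2) (u : L2) :
    fourierConj T (fourierL2 u) = fourierL2 (T u) := by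
  simp [fourierConj]

/-- A Fourier multiplier acts by multiplication on the Fourier side. -/
theorem IsMultOp.isMulBy_fourierConj {m : ℝ → ℝ} {T : L2 →L[ℂ] L2} (hT : IsMultOp m T)
    (hm : Continuous m) {C : ℝ} (hC : ∀ k, |m k| ≤ C) :
    IsMulBy (fun ξ => m (2 * Real.pi * ξ)) (fourierConj T) := by
  obtain ⟨S, hS⟩ := exists_isMulBy (c := fun ξ => m (2 * Real.pi * ξ)) (by fun_prop)
    (fun x => hC _)
  suffices h : fourierConj T = S by rwa [h]
  refine eq_of_eq_on_schwartz fun χ => ?_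
  obtain ⟨φ, rfl⟩ : ∃ φ : 𝓢(ℝ, ℂ), 𝓕 φ = χ := ⟨𝓕⁻ χ, FourierTransform.fourier_fourierInv_eq χ⟩
  refine ext_inner_schwartz fun χ => ?_
  obtain ⟨ψ, rfl⟩ : ∃ ψ : 𝓢(ℝ, ℂ), 𝓕 ψ = χ := ⟨𝓕⁻ χ, FourierTransform.fourier_fourierInv_eq χ⟩
  rw [← hT.inner_schwartz hm hC hS, ← fourierL2_toLp, ← fourierL2_toLp, fourierConj_apply,
    LinearIsometryEquiv.inner_map_map]

theorem norm_eq_norm_fourierConj (T : L2 →L[ℂ] L2) (u : L2) :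
    ‖T u‖ = ‖fourierConj T (fourierL2 u)‖ := by
  rw [fourierConj_apply, LinearIsometryEquiv.norm_map]

theorem fourierConj_one : fourierConj 1 = 1 := by
  ext1 u
  simp [fourierConj]

theorem fourierConj_sub (S T : L2 →L[ℂ] L2) :
    fourierConj (S - T) = fourierConj S - fourierConj T := by
  ext1 u
  simp [fourierConj]

theorem fourierConj_smul (a : ℂ) (T : L2 →L[ℂ] L2) :
    fourierConj (a • T) = a • fourierConj T := by
  ext1 u
  simp [fourierConj]

theorem fourierConj_comp (S T : L2 →L[ℂ] L2) :
    fourierConj (S.comp T) = (fourierConj S).comp (fourierConj T) := by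
  ext1 u
  simp [fourierConj]

namespace IsMulBy

variable {b c : ℝ → ℝ} {S T : L2 →L[ℂ] L2}

theorem norm_apply_le_of_mem_Icc (hT : IsMulBy c T) (hc : ∀ x, c x ∈ Icc 0 1) (f : L2) :
    ‖T f‖ ≤ ‖f‖ := by
  simpa using hT.norm_apply_le (C := 1)
    (fun x => abs_le.2 ⟨by linarith [(hc x).1], (hc x).2⟩) f

theorem norm_sub_apply_le_of_mem_Icc (hT : IsMulBy c T) (hc : ∀ x, c x ∈ Icc 0 1) (f : L2) :
    ‖(1 - T) f‖ ≤ ‖f‖ :=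
  (one.sub hT).norm_apply_le_of_mem_Icc (fun x => by
    simp only [Pi.sub_apply, Pi.one_apply]
    constructor <;> linarith [(hc x).1, (hc x).2]) f

theorem norm_sub_two_smul_apply_le_of_mem_Icc (hT : IsMulBy c T) (hc : ∀ x, c x ∈ Icc 0 1)
    (f : L2) : ‖(1 - ((2 : ℝ) : ℂ) • T) f‖ ≤ ‖f‖ := by
  simpa using (one.sub (hT.smul 2)).norm_apply_le (C := 1) (fun x => by
    simp only [Pi.sub_apply, Pi.one_apply, Pi.smul_apply, smul_eq_mul]
    rw [abs_le]
    constructor <;> linarith [(hc x).1, (hc x).2]) f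

end IsMulBy

theorem smoothBox_mem_Icc {W : ℝ} (hW : 0 ≤ W) (t : ℝ) : smoothBox W t ∈ Icc 0 1 :=
  ⟨smoothBox_nonneg hW t, smoothBox_le_one W t⟩

theorem abs_one_sub_smoothBox_mul_le {a W t s : ℝ} (ha : 0 ≤ a) (hW : 3 * a ≤ W)
    (hts : 2 * |t| ≤ |s|) : |(1 - smoothBox W t) * smoothBox W s| ≤ erfc' a := by
  rw [abs_of_nonneg]
  · exact one_sub_smoothBox_mul_le ha hW hts
  · exact mul_nonneg (sub_nonneg.2 (smoothBox_le_one W t)) (smoothBox_nonneg (by linarith) s)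

/-- ‖Σ_{m=0}^{M} f⁺ₘ − [(1−P₀)f + Σ_{m=1}^{M}(1−Pₘ)(Pₘ₋₁⋯P₀)f]‖
  ≤ δ₁(M³ + 9M² + (20+150 kmax)M + 150 kmax + 12 kmax + 12(M+1))‖f‖. -/
theorem stmt5 (L kmax σ δ₁ : ℝ) (hL : 0 < L) (hk : 0 < kmax) (hσ : 0 < σ)
    (hδpos : 0 < δ₁) (hδle : δ₁ ≤ erfc' 1)
    (hσlo : 8 * erfcInv δ₁ / kmax ≤ σ) (hσhi : σ ≤ L / (8 * erfcInv δ₁))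
    (X P : ℕ → (L2 →L[ℂ] L2))
    (hX : ∀ m, IsMulBy (chiSc L σ m) (X m)) (hP : ∀ m, IsMultOp (PSc kmax σ m) (P m))
    (f : L2)
    -- f is phase-space localized with tolerance δ₁:
    (hloc : ∀ m, ‖(1 - P m) f - X m ((1 - P m) (X m f))‖ ≤ δ₁ * ‖f‖)
    -- the recursive multiscale decomposition f⁺ₘ, f⁻ₘ:
    (fp fm : ℕ → L2)
    (hfp0 : fp 0 = X 0 ((1 - P 0) (X 0 f)))
    (hfm0 : fm 0 = f - fp 0)
    (hfpS : ∀ m, fp (m+1) = X (m+1) ((1 - P (m+1)) (X (m+1) (fm m))))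
    (hfmS : ∀ m, fm (m+1) = fm m - fp (m+1))
    -- R m = Pₘ₋₁ ∘ ⋯ ∘ P₀ (with R 0 = id):
    (R : ℕ → (L2 →L[ℂ] L2))
    (hR0 : R 0 = 1)
    (hRS : ∀ m, R (m+1) = (P m).comp (R m))
    (M : ℕ) :
    ‖(∑ m ∈ Finset.range (M+1), fp m)
        - ((1 - P 0) f + ∑ m ∈ Finset.Icc 1 M, (1 - P m) (R m f))‖
      ≤ δ₁ * ((M:ℝ)^3 + 9*(M:ℝ)^2 + (20 + 150*kmax)*(M:ℝ)
          + 150*kmax + 12*kmax + 12*((M:ℝ)+1)) * ‖f‖ := by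
  set a := erfcInv δ₁
  have ha : 0 < a := erfcInv_pos hδpos hδle
  have hδa : erfc' a = δ₁ := erfc'_erfcInv hδpos hδle
  have hWX : 3 * a ≤ 3 * L / 4 / σ := by
    rw [le_div_iff₀ (by positivity)] at hσhi ⊢
    nlinarith
  have hWP : 3 * a ≤ σ * (3 * kmax / 8) := by
    rw [div_le_iff₀ hk] at hσlo
    linarith
  have hcX : ∀ m x, chiSc L σ m x ∈ Icc 0 1 := fun m x => by
    rw [chiSc_eq]
    exact smoothBox_mem_Icc (by linarith) _
  have hcP : ∀ m k, PSc kmax σ m k ∈ Icc 0 1 := fun m k => by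
    rw [PSc_eq]
    exact smoothBox_mem_Icc (by linarith) _
  have hcontP : ∀ m, Continuous (PSc kmax σ m) := fun m => by
    have h := continuous_smoothBox (σ * (3 * kmax / 8))
    rw [funext (PSc_eq kmax σ m)]
    fun_prop
  have hPhat : ∀ m, IsMulBy (fun ξ => PSc kmax σ m (2 * Real.pi * ξ)) (fourierConj (P m)) :=
    fun m => (hP m).isMulBy_fourierConj (hcontP m) (C := 1)
      (fun k => abs_le.2 ⟨by linarith [(hcP m k).1], (hcP m k).2⟩)
  have hXX : ∀ m u, ‖X m u - X (m + 1) (X m u)‖ ≤ δ₁ * ‖u‖ := fun m u => by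
    refine ((IsMulBy.one.sub (hX (m + 1))).comp (hX m)).norm_apply_le (fun x => ?_) u
    simp only [Pi.mul_apply, Pi.sub_apply, Pi.one_apply]
    rw [chiSc_eq, chiSc_eq, ← hδa]
    refine abs_one_sub_smoothBox_mul_le ha.le hWX (le_of_eq ?_)
    rw [← abs_two, ← abs_mul, abs_two, pow_succ]
    congr 1
    field_simp
  have hPQ : ∀ i j u, i < j → ‖P j (u - P i u)‖ ≤ δ₁ * ‖u‖ := fun i j u hij => by
    have hu : P j (u - P i u) = ((P j).comp (1 - P i)) u := rfl
    rw [hu, norm_eq_norm_fourierConj, fourierConj_comp, fourierConj_sub, fourierConj_one,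
      ← fourierL2.norm_map u]
    refine ((hPhat j).comp (IsMulBy.one.sub (hPhat i))).norm_apply_le (fun ξ => ?_) _
    simp only [Pi.mul_apply, Pi.sub_apply, Pi.one_apply]
    rw [PSc_eq, PSc_eq, ← hδa, mul_comm]
    refine abs_one_sub_smoothBox_mul_le ha.le hWP ?_
    obtain ⟨n, rfl⟩ := Nat.exists_eq_add_of_lt hij
    have h2 : (2 : ℝ) * 2 ^ i ≤ 2 ^ (i + n + 1) := by
      rw [← pow_succ']
      exact pow_le_pow_right₀ one_le_two (by lia)
    simp only [abs_mul, abs_pow, abs_two]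
    calc _ = (2 * 2 ^ i) * (|σ| * (|Real.pi| * |ξ|) * 2) := by ring
      _ ≤ 2 ^ (i + n + 1) * (|σ| * (|Real.pi| * |ξ|) * 2) := by gcongr
      _ = _ := by ring
  have hrem := norm_remainder_sub_prod_le
    (fun m => (hX m).norm_apply_le_of_mem_Icc (hcX m))
    (fun m => (hX m).norm_sub_apply_le_of_mem_Icc (hcX m))
    (fun m => (hX m).inner_apply_left) hXX
    (fun m u => by
      rw [norm_eq_norm_fourierConj, ← fourierL2.norm_map u]
      exact (hPhat m).norm_apply_le_of_mem_Icc (fun _ => hcP m _) _)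
    (fun m u => by
      change ‖(1 - P m) u‖ ≤ _
      rw [norm_eq_norm_fourierConj, ← fourierL2.norm_map u, fourierConj_sub, fourierConj_one]
      exact (hPhat m).norm_sub_apply_le_of_mem_Icc (fun _ => hcP m _) _)
    (fun m u => by
      change ‖(1 - ((2 : ℝ) : ℂ) • P m) u‖ ≤ _
      rw [norm_eq_norm_fourierConj, ← fourierL2.norm_map u, fourierConj_sub, fourierConj_one,
        fourierConj_smul]
      exact (hPhat m).norm_sub_two_smul_apply_le_of_mem_Icc (fun _ => hcP m _) _)
    hPQ hδpos.le hloc hfp0 hfm0 hfpS hfmS hR0 hRS M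
  rw [sum_eq_sub_remainder hfm0 hfmS, sum_telescope_prod f hR0 hRS, sub_sub_sub_cancel_left,
    norm_sub_rev]
  refine hrem.trans ?_
  have hM : (0 : ℝ) ≤ M := M.cast_nonneg
  have hkM : 0 ≤ kmax * M := by positivity
  rw [mul_comm _ δ₁]
  refine mul_le_mul_of_nonneg_right (mul_le_mul_of_nonneg_left ?_ hδpos.le) (norm_nonneg f)
  nlinarith [pow_nonneg hM 3, pow_nonneg hM 2]

end
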